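/- arXiv:2603.11925 — 2 statements merged into one kernel-verified Lean document; each statement's English description precedes it below -/
import Mathlib

section
/- Let d be a positive natural number and let Φ be a linear map on the d×d complex matrices that is completely positive and trace preserving. Then there exist a natural number N ≤ d² and matrices K_1, …, K_N ∈ M_d(ℂ) with ∑_{α=1}^N K_α† K_α = 1 (the identity matrix) such that Φ(X) = ∑_{α=1}^N K_α X K_α† for all X ∈ M_d(ℂ). -/
open Matrix
open scoped ComplexOrder

/-- The map `Φ ⊗ id_n` acting blockwise on matrices indexed by `Fin d × Fin n`. -/
def blockMap {d : ℕ} (Φ : Matrix (Fin d) (Fin d) ℂ → Matrix (Fin d) (Fin d) ℂ) (n : ℕ)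
    (A : Matrix (Fin d × Fin n) (Fin d × Fin n) ℂ) : Matrix (Fin d × Fin n) (Fin d × Fin n) ℂ :=
  Matrix.of fun p q => Φ (Matrix.of fun i j => A (i, p.2) (j, q.2)) p.1 q.1

/-- A map on `d × d` complex matrices is completely positive if `Φ ⊗ id_n` preserves
positive semidefiniteness for every `n ≥ 1`. -/
def IsCompletelyPositive {d : ℕ} (Φ : Matrix (Fin d) (Fin d) ℂ → Matrix (Fin d) (Fin d) ℂ) :
    Prop :=
  ∀ n : ℕ, 1 ≤ n → ∀ A : Matrix (Fin d × Fin n) (Fin d × Fin n) ℂ,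
    A.PosSemidef → (blockMap Φ n A).PosSemidef

/-- A map on `d × d` complex matrices is trace preserving if it preserves the trace. -/
def IsTracePreserving {d : ℕ} (Φ : Matrix (Fin d) (Fin d) ℂ → Matrix (Fin d) (Fin d) ℂ) :
    Prop :=
  ∀ X : Matrix (Fin d) (Fin d) ℂ, (Φ X).trace = X.trace

/-- Kraus representation theorem: every CPTP map on `d × d` complex matrices has the form
`X ↦ ∑ α, K α * X * (K α)ᴴ` with at most `d ^ 2` Kraus operators satisfying
`∑ α, (K α)ᴴ * K α = 1`. -/
theorem kraus_representation (d : ℕ) (hd : 0 < d)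
    (Φ : Matrix (Fin d) (Fin d) ℂ →ₗ[ℂ] Matrix (Fin d) (Fin d) ℂ)
    (hCP : IsCompletelyPositive (fun X => Φ X))
    (hTP : IsTracePreserving (fun X => Φ X)) :
    ∃ (N : ℕ) (_ : N ≤ d ^ 2) (K : Fin N → Matrix (Fin d) (Fin d) ℂ),
      (∑ α, (K α)ᴴ * K α = 1) ∧ ∀ X, Φ X = ∑ α, K α * X * (K α)ᴴ := by
  classical
  -- the Choi matrix
  let v : Fin d × Fin d → ℂ := fun p => if p.1 = p.2 then 1 else 0
  have hC := hCP d hd _ (posSemidef_vecMulVec_self_star v)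
  obtain ⟨B, hB⟩ : ∃ B : Matrix (Fin d × Fin d) (Fin d × Fin d) ℂ,
      blockMap (fun X => Φ X) d (vecMulVec v (star v)) = Bᴴ * B := by
    open scoped MatrixOrder in
    exact CStarAlgebra.nonneg_iff_eq_star_mul_self.mp hC.nonneg
  have hent : ∀ i j k l, Φ (Matrix.single k l 1) i j
      = ∑ r, star (B r (i, k)) * B r (j, l) := by
    intro i j k l
    have h := congrFun (congrFun hB (i, k)) (j, l)
    simp only [blockMap, Matrix.of_apply, Matrix.mul_apply, conjTranspose_apply] at h
    rw [← h]
    refine congrArg (fun M => Φ M i j) ?_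
    ext a b
    by_cases h1 : k = a <;> by_cases h2 : l = b <;>
      simp [v, vecMulVec_apply, Matrix.single_apply, h1, h2, eq_comm]
  let K' : Fin d × Fin d → Matrix (Fin d) (Fin d) ℂ := fun r =>
    Matrix.of fun i k => star (B r (i, k))
  have hK' : ∀ X, Φ X = ∑ r, K' r * X * (K' r)ᴴ := by
    intro X
    ext i j
    conv_lhs => rw [Matrix.matrix_eq_sum_single X]
    have hs : ∀ k l, Matrix.single k l (X k l) = X k l • Matrix.single k l (1 : ℂ) := by
      intro k l
      simp
    simp only [hs, map_sum, map_smul, Matrix.sum_apply, Matrix.smul_apply, hent, smul_eq_mul,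
      Matrix.mul_apply, conjTranspose_apply, K', Matrix.of_apply, star_star, Finset.mul_sum,
      Finset.sum_mul]
    rw [Finset.sum_comm]
    conv_rhs => rw [Finset.sum_comm]
    refine Finset.sum_congr rfl fun l _ => ?_
    rw [Finset.sum_comm]
    refine Finset.sum_congr rfl fun r _ => Finset.sum_congr rfl fun k _ => ?_
    ring
  let e : Fin (d ^ 2) ≃ Fin d × Fin d := (finCongr (pow_two d)).trans finProdFinEquiv.symm
  have hK : ∀ X, Φ X = ∑ α, K' (e α) * X * (K' (e α))ᴴ := by
    intro X
    rw [hK' X]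
    exact (e.sum_comp (fun r => K' r * X * (K' r)ᴴ)).symm
  refine ⟨d ^ 2, le_rfl, fun α => K' (e α), ?_, hK⟩
  rw [Matrix.ext_iff_trace_mul_right]
  intro X
  have h := hTP X
  simp only [hK X, trace_sum] at h
  rw [one_mul, ← h, Finset.sum_mul, trace_sum]
  refine Finset.sum_congr rfl fun α _ => ?_
  rw [Matrix.trace_mul_comm (K' (e α) * X), Matrix.mul_assoc]
end

section
/- Let g > 0, Γ > 0, and Δ be real numbers, and let c ∈ ℂ. Let R ∈ ℂ be a complex number with R ≠ 0 and R² = (Γ − iΔ)² − 4g/√(2π). Define f : ℝ → ℂ by f(τ) = (g/√(2π)) e^{−(Γ − iΔ)τ}, and define c₁ : ℝ → ℂ by c₁(t) = c · e^{−(Γ − iΔ)t/2} · (cosh(Rt/2) + ((Γ − iΔ)/R) sinh(Rt/2)). Then c₁(0) = c, and for every t ≥ 0 the function c₁ is differentiable at t with derivative c₁′(t) = −∫₀^t f(t − s) c₁(s) ds. -/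
open MeasureTheory

/-- The explicit solution of the integro-differential equation
`c₁′(t) = −∫₀ᵗ f(t−s) c₁(s) ds` with the exponential memory kernel
`f(τ) = (g/√(2π)) e^{−(Γ−iΔ)τ}`. -/
theorem jaynes_cummings_amplitude_solution (g Γ Δ : ℝ) (hg : 0 < g) (hΓ : 0 < Γ)
    (c : ℂ) (R : ℂ) (hR0 : R ≠ 0)
    (hR : R ^ 2 = ((Γ : ℂ) - Complex.I * (Δ : ℂ)) ^ 2 -
      ((4 * g / Real.sqrt (2 * Real.pi) : ℝ) : ℂ))
    (f : ℝ → ℂ)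
    (hf : ∀ τ : ℝ, f τ = ((g / Real.sqrt (2 * Real.pi) : ℝ) : ℂ) *
      Complex.exp (-(((Γ : ℂ) - Complex.I * (Δ : ℂ)) * (τ : ℂ))))
    (c₁ : ℝ → ℂ)
    (hc : ∀ t : ℝ, c₁ t = c * Complex.exp (-(((Γ : ℂ) - Complex.I * (Δ : ℂ)) * (t : ℂ)) / 2) *
      (Complex.cosh (R * (t : ℂ) / 2) +
        (((Γ : ℂ) - Complex.I * (Δ : ℂ)) / R) * Complex.sinh (R * (t : ℂ) / 2))) :
    c₁ 0 = c ∧ ∀ t : ℝ, 0 ≤ t →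
      HasDerivAt c₁ (-(∫ s in (0:ℝ)..t, f (t - s) * c₁ s)) t := by
  have hk : ((4 * g / Real.sqrt (2 * Real.pi) : ℝ) : ℂ)
      = 4 * ((g / Real.sqrt (2 * Real.pi) : ℝ) : ℂ) := by
    rw [mul_div_assoc]; push_cast; ring
  rw [hk] at hR
  generalize ((g / Real.sqrt (2 * Real.pi) : ℝ) : ℂ) = k at *
  generalize (Γ : ℂ) - Complex.I * (Δ : ℂ) = a at *
  refine ⟨by simp [hc], fun t _ => ?_⟩
  have hlin : ∀ (b : ℂ) (x : ℝ), HasDerivAt (fun s : ℝ => b * (s : ℂ) / 2) (b / 2) x := by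
    intro b x
    have h := ((Complex.ofRealCLM.hasDerivAt (x := x)).const_mul b).div_const 2
    simpa using h
  have hsinh : ∀ (b : ℂ) (x : ℝ), HasDerivAt (fun s : ℝ => Complex.sinh (b * (s : ℂ) / 2))
      (Complex.cosh (b * (x : ℂ) / 2) * (b / 2)) x := fun b x =>
    (Complex.hasDerivAt_sinh _).comp x (hlin b x)
  have hcosh : ∀ (b : ℂ) (x : ℝ), HasDerivAt (fun s : ℝ => Complex.cosh (b * (s : ℂ) / 2))
      (Complex.sinh (b * (x : ℂ) / 2) * (b / 2)) x := fun b x =>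
    (Complex.hasDerivAt_cosh _).comp x (hlin b x)
  have hF : (fun s : ℝ => f (t - s) * c₁ s) = fun s : ℝ => k * c * Complex.exp (-(a * t)) *
      (Complex.exp (a * s / 2) * (Complex.cosh (R * s / 2) + a / R * Complex.sinh (R * s / 2))) := by
    funext s
    rw [hf, hc]
    have h : Complex.exp (-(a * ((t - s : ℝ) : ℂ))) * Complex.exp (-(a * s) / 2)
        = Complex.exp (-(a * t)) * Complex.exp (a * s / 2) := by
      rw [← Complex.exp_add, ← Complex.exp_add]
      congr 1
      push_cast
      ring
    linear_combination (k * c * (Complex.cosh (R * s / 2) + a / R * Complex.sinh (R * s / 2))) * h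
  have hG : ∀ x : ℝ, HasDerivAt (fun s : ℝ => k * c * Complex.exp (-(a * t)) *
      (Complex.exp (a * s / 2) * (2 / R * Complex.sinh (R * s / 2))))
      (k * c * Complex.exp (-(a * t)) *
      (Complex.exp (a * x / 2) * (Complex.cosh (R * x / 2) + a / R * Complex.sinh (R * x / 2)))) x := by
    intro x
    have h := ((hlin a x).cexp.mul ((hsinh R x).const_mul (2 / R))).const_mul
      (k * c * Complex.exp (-(a * t)))
    refine h.congr_deriv ?_
    field_simp
    ring
  have hint : (∫ s in (0:ℝ)..t, f (t - s) * c₁ s) =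
      k * c * Complex.exp (-(a * t) / 2) * (2 / R * Complex.sinh (R * t / 2)) := by
    rw [hF, intervalIntegral.integral_eq_sub_of_hasDerivAt (fun x _ => hG x)]
    · have h : Complex.exp (-(a * t)) * Complex.exp (a * t / 2) = Complex.exp (-(a * t) / 2) := by
        rw [← Complex.exp_add]
        congr 1
        ring
      rw [← h]
      simp
      ring
    · apply Continuous.intervalIntegrable
      fun_prop
  rw [hint, funext hc]
  have h1 : HasDerivAt (fun s : ℝ => Complex.exp (-(a * s) / 2))
      (Complex.exp (-(a * t) / 2) * (-a / 2)) t := by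
    have h := (hlin (-a) t).cexp
    simpa only [neg_mul] using h
  have h := (h1.const_mul c).mul ((hcosh R t).add ((hsinh R t).const_mul (a / R)))
  refine h.congr_deriv ?_
  have hk2 : k = (a ^ 2 - R ^ 2) / 4 := by rw [hR]; ring
  rw [hk2]
  simp only [Pi.add_apply]
  field_simp
  ring
end
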